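/- arXiv:2405.04720 — 3 statements merged into one kernel-verified Lean document; each statement's English description precedes it below -/
import Mathlib

section
/- The second derivative g''(α) tends to 1/a_∞ as α → 1⁺. -/
/-- The 1-shock branch of the elementary wave curve of the isothermal hypersonic
small-disturbance system: `g(α) = −(√2/a)·√((α−1)·ln α/(α+1))`. -/
noncomputable def gShock (a α : ℝ) : ℝ :=
  -(Real.sqrt 2 / a) * Real.sqrt ((α - 1) * Real.log α / (α + 1))

theorem AnalyticAt.dslope_self {f : ℝ → ℝ} {x : ℝ} (hf : AnalyticAt ℝ f x) :
    AnalyticAt ℝ (dslope f x) x := by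
  obtain ⟨p, hp⟩ := hf
  exact hp.has_fpower_series_dslope_fslope.analyticAt

theorem deriv_deriv_sub_mul_self {f : ℝ → ℝ} {x : ℝ} (hf : AnalyticAt ℝ f x) :
    deriv (deriv fun y => (y - x) * f y) x = 2 * deriv f x := by
  have hderiv : deriv (fun y => (y - x) * f y) =ᶠ[nhds x] fun y => f y + (y - x) * deriv f y := by
    filter_upwards [hf.eventually_analyticAt] with y hy
    refine (((hasDerivAt_id y).sub_const x).mul hy.differentiableAt.hasDerivAt).deriv.trans ?_
    simp
  have h := hf.differentiableAt.hasDerivAt.add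
    (((hasDerivAt_id x).sub_const x).mul hf.deriv.differentiableAt.hasDerivAt)
  rw [hderiv.deriv_eq]
  refine h.deriv.trans ?_
  simp
  ring

theorem analyticAt_dslope_log_one : AnalyticAt ℝ (dslope Real.log 1) 1 :=
  (analyticAt_log one_pos).dslope_self

theorem sub_mul_dslope_log_one (y : ℝ) : (y - 1) * dslope Real.log 1 y = Real.log y := by
  simpa using sub_smul_dslope Real.log 1 y

theorem dslope_log_one_self : dslope Real.log 1 1 = 1 := by
  simp

theorem deriv_dslope_log_one : deriv (dslope Real.log 1) 1 = -1 / 2 := by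
  have h := deriv_deriv_sub_mul_self analyticAt_dslope_log_one
  simp only [sub_mul_dslope_log_one, Real.deriv_log', deriv_inv] at h
  norm_num at h
  linarith

theorem hasDerivAt_dslope_log_div :
    HasDerivAt (fun y => dslope Real.log 1 y / (y + 1)) (-1 / 2) 1 := by
  have h := analyticAt_dslope_log_one.differentiableAt.hasDerivAt.div
    ((hasDerivAt_id (1 : ℝ)).add_const 1) (by norm_num)
  refine h.congr_deriv ?_
  rw [deriv_dslope_log_one, dslope_log_one_self]
  norm_num

theorem analyticAt_sqrt_dslope_log_div :
    AnalyticAt ℝ (fun y => √(dslope Real.log 1 y / (y + 1))) 1 := by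
  have h : AnalyticAt ℝ (fun y => dslope Real.log 1 y / (y + 1)) 1 :=
    analyticAt_dslope_log_one.div (analyticAt_id.add analyticAt_const) (by norm_num)
  exact (h.contDiffAt.sqrt (by rw [dslope_log_one_self]; norm_num)).analyticAt

theorem deriv_sqrt_dslope_log_div :
    deriv (fun y => √(dslope Real.log 1 y / (y + 1))) 1 = -√2 / 4 := by
  rw [(hasDerivAt_dslope_log_div.sqrt (by rw [dslope_log_one_self]; norm_num)).deriv,
    dslope_log_one_self]
  have h : √((1 : ℝ) / (1 + 1)) = 1 / √2 := by
    rw [Real.sqrt_div zero_le_one]; norm_num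
  rw [h]
  field_simp
  norm_num

theorem gShock_eq_of_one_lt (a : ℝ) {y : ℝ} (hy : 1 < y) :
    gShock a y = (y - 1) * (-(√2 / a) * √(dslope Real.log 1 y / (y + 1))) := by
  have h : (y - 1) * Real.log y / (y + 1) = (y - 1) ^ 2 * (dslope Real.log 1 y / (y + 1)) := by
    rw [← sub_mul_dslope_log_one y]; ring
  rw [gShock, h, Real.sqrt_mul (sq_nonneg _), Real.sqrt_sq (by linarith)]
  ring

/-- The second derivative `g''(α)` tends to `1/a_∞` as `α → 1⁺`. -/
theorem gShock_second_deriv_limit (a : ℝ) (ha : 0 < a) :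
    Filter.Tendsto (deriv (deriv (gShock a))) (nhdsWithin 1 (Set.Ioi 1)) (nhds (1 / a)) := by
  have hf : AnalyticAt ℝ (fun y => -(√2 / a) * √(dslope Real.log 1 y / (y + 1))) 1 :=
    analyticAt_const.mul analyticAt_sqrt_dslope_log_div
  have hG := ((analyticAt_id.sub (analyticAt_const (v := (1 : ℝ)))).mul hf).deriv.deriv
  have hval := deriv_deriv_sub_mul_self hf
  rw [deriv_const_mul _ analyticAt_sqrt_dslope_log_div.differentiableAt,
    deriv_sqrt_dslope_log_div] at hval
  have hone : 2 * (-(√2 / a) * (-√2 / 4)) = 1 / a := by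
    have h2 : √2 * √2 = (2 : ℝ) := Real.mul_self_sqrt zero_le_two
    field_simp
    linarith
  rw [← hone, ← hval]
  refine (hG.continuousAt.tendsto.mono_left nhdsWithin_le_nhds).congr' ?_
  filter_upwards [self_mem_nhdsWithin] with y hy
  refine Filter.EventuallyEq.deriv_eq (Filter.EventuallyEq.deriv ?_)
  filter_upwards [Ioi_mem_nhds hy] with z hz
  exact (gShock_eq_of_one_lt a hz).symm
end

section
/- There exist positive constants δ₀, ε₀, τ₀ and C, depending only on a_∞ and K, such that whenever 0 < δ < δ₀, 0 < ε < ε₀, 0 < τ < τ₀ and β₁ > 0 satisfies |β₁ − 1 − a_∞δ| ≤ K(δ + ε + τ²)δ, one has |((((β₁+1)ε + 1)·ε·β₁^ε·ln β₁ − β₁^ε + 1)/ε² − 2a_∞δ| ≤ C(δ + ε + τ²)δ. -/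
theorem abs_log_sub_sub_one_le {β : ℝ} (h : |β - 1| ≤ 1 / 2) :
    |Real.log β - (β - 1)| ≤ 2 * (β - 1) ^ 2 := by
  obtain ⟨h₁, h₂⟩ := abs_le.mp h
  have hβ : 0 < β := by linarith
  have hu := Real.log_le_sub_one_of_pos hβ
  have hl := Real.one_sub_inv_le_log_of_pos hβ
  have key : (β - 1) - 2 * (β - 1) ^ 2 ≤ 1 - β⁻¹ := by
    have e : 1 - β⁻¹ - ((β - 1) - 2 * (β - 1) ^ 2) = (β - 1) ^ 2 * (2 * β - 1) / β := by
      field_simp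
      ring
    have : 0 ≤ (β - 1) ^ 2 * (2 * β - 1) / β :=
      div_nonneg (mul_nonneg (sq_nonneg _) (by linarith)) hβ.le
    linarith
  exact abs_le.mpr ⟨by linarith, by nlinarith [sq_nonneg (β - 1)]⟩

theorem abs_mul_exp_sub_exp_add_one_le {u : ℝ} (h : |u| ≤ 1) :
    |u * Real.exp u - Real.exp u + 1| ≤ 3 * u ^ 2 := by
  have h₁ := Real.abs_exp_sub_one_le h
  have h₂ := Real.abs_exp_sub_one_sub_id_le h
  calc |u * Real.exp u - Real.exp u + 1|
      = |u * (Real.exp u - 1) - (Real.exp u - 1 - u)| := by ring_nf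
    _ ≤ |u * (Real.exp u - 1)| + |Real.exp u - 1 - u| := abs_sub _ _
    _ ≤ |u| * (2 * |u|) + u ^ 2 := by
        rw [abs_mul]
        gcongr
    _ = 3 * u ^ 2 := by rw [← sq_abs u]; ring

theorem abs_shock_mixed_sub_le {ε β : ℝ} (hε : 0 < ε) (hε1 : ε < 1) (h : |β - 1| ≤ 1 / 2) :
    |(((β + 1) * ε + 1) * ε * β ^ ε * Real.log β - β ^ ε + 1) / ε ^ 2 - 2 * (β - 1)| ≤
      38 * (β - 1) ^ 2 := by
  have hβ : 0 < β := by linarith [(abs_le.mp h).1]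
  have hlog := abs_log_sub_sub_one_le h
  rw [Real.rpow_def_of_pos hβ]
  set L := Real.log β
  set x := β - 1 with hx
  have hL : |L| ≤ 2 * |x| := by
    have h₁ : |L| ≤ |L - x| + |x| := by simpa using abs_add_le (L - x) x
    nlinarith [abs_nonneg x, sq_abs x]
  have hu : |L * ε| ≤ ε * |L| := by rw [abs_mul, abs_of_pos hε, mul_comm]
  have hu' : |L * ε| ≤ |L| := by nlinarith [abs_nonneg L]
  have hu1 : |L * ε| ≤ 1 := by linarith
  have he := Real.abs_exp_sub_one_le hu1
  have hq := abs_mul_exp_sub_exp_add_one_le hu1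
  set w := Real.exp (L * ε)
  have split : (((β + 1) * ε + 1) * ε * w * L - w + 1) / ε ^ 2 - 2 * x =
      (2 + x) * L * (w - 1) + x * L + 2 * (L - x) + (L * ε * w - w + 1) / ε ^ 2 := by
    rw [hx]
    field_simp
    ring
  have hquot : |(L * ε * w - w + 1) / ε ^ 2| ≤ 3 * |L| ^ 2 := by
    rw [abs_div, abs_of_pos (pow_pos hε 2), div_le_iff₀ (pow_pos hε 2), sq_abs]
    linarith
  have h2x : |2 + x| ≤ 5 / 2 := by
    obtain ⟨h₁, h₂⟩ := abs_le.mp h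
    exact abs_le.mpr ⟨by linarith, by linarith⟩
  have hmain : |(2 + x) * L * (w - 1)| ≤ 5 / 2 * |L| * (2 * |L|) := by
    rw [abs_mul, abs_mul]
    gcongr
    linarith
  have hlin : |2 * (L - x)| ≤ 4 * |x| ^ 2 := by
    rw [abs_mul, abs_two, sq_abs]
    linarith
  rw [split]
  calc _ ≤ |(2 + x) * L * (w - 1)| + |x * L| + |2 * (L - x)| +
          |(L * ε * w - w + 1) / ε ^ 2| :=
        (abs_add_le _ _).trans (add_le_add_left (abs_add_three _ _ _) _)
    _ ≤ 5 / 2 * |L| * (2 * |L|) + |x| * |L| + 4 * |x| ^ 2 + 3 * |L| ^ 2 := by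
        rw [abs_mul x L]
        gcongr
    _ ≤ 5 / 2 * (2 * |x|) * (2 * (2 * |x|)) + |x| * (2 * |x|) + 4 * |x| ^ 2 +
          3 * (2 * |x|) ^ 2 := by
        gcongr
    _ = 38 * x ^ 2 := by rw [← sq_abs x]; ring

/-- If the 1-shock strength satisfies the expansion `β₁ = 1 + a_∞δ + O(δ+ε+τ²)δ`, then
`(((β₁+1)ε + 1)·ε·β₁^ε·ln β₁ − β₁^ε + 1)/ε² = 2a_∞δ + O(δ+ε+τ²)δ`, with constants
depending only on `a_∞` and `K`. -/
theorem shock_mixed_estimate (a K : ℝ) (ha : 0 < a) (hK : 0 < K) :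
    ∃ δ₀ ε₀ τ₀ C : ℝ, 0 < δ₀ ∧ 0 < ε₀ ∧ 0 < τ₀ ∧ 0 < C ∧
      ∀ δ ε τ β : ℝ, 0 < δ → δ < δ₀ → 0 < ε → ε < ε₀ → 0 < τ → τ < τ₀ → 0 < β →
        |β - 1 - a * δ| ≤ K * (δ + ε + τ ^ 2) * δ →
        |(((β + 1) * ε + 1) * ε * β ^ ε * Real.log β - β ^ ε + 1) / ε ^ 2 - 2 * a * δ| ≤
          C * (δ + ε + τ ^ 2) * δ := by
  set M := a + 3 * K with hM
  have hMpos : 0 < M := by positivity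
  refine ⟨min 1 (1 / (2 * M)), 1, 1, 38 * M ^ 2 + 2 * K, by positivity, one_pos, one_pos,
    by positivity, ?_⟩
  intro δ ε τ β hδ hδ₀ hε hε1 hτ hτ1 _ h
  have hδ1 : δ < 1 := hδ₀.trans_le (min_le_left _ _)
  have hδM : M * δ ≤ 1 / 2 := by
    have := hδ₀.trans_le (min_le_right _ _)
    rw [lt_div_iff₀ (by positivity)] at this
    linarith
  have hτ2 : τ ^ 2 ≤ 1 := by nlinarith
  have hx : |β - 1| ≤ M * δ := by
    have h₁ : |β - 1| ≤ |β - 1 - a * δ| + |a * δ| := by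
      simpa using abs_add_le (β - 1 - a * δ) (a * δ)
    have h₂ : K * (δ + ε + τ ^ 2) * δ ≤ K * 3 * δ := by
      gcongr
      linarith
    rw [abs_of_pos (mul_pos ha hδ)] at h₁
    rw [hM]
    linarith
  have hmain := abs_shock_mixed_sub_le hε hε1 (hx.trans hδM)
  have hsq : (β - 1) ^ 2 ≤ M ^ 2 * ((δ + ε + τ ^ 2) * δ) := by
    calc (β - 1) ^ 2 = |β - 1| ^ 2 := (sq_abs _).symm
      _ ≤ (M * δ) ^ 2 := by gcongr
      _ = M ^ 2 * (δ * δ) := by ring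
      _ ≤ M ^ 2 * ((δ + ε + τ ^ 2) * δ) := by
          gcongr
          linarith [sq_nonneg τ]
  rw [abs_le] at h hmain ⊢
  constructor <;> linarith [h.1, h.2, hmain.1, hmain.2]
end

section
/- There exist δ₀ > 0 and C > 0, depending only on a_∞, such that for every δ ∈ (0, δ₀) the equation φ₁(α) + δ = 0 has a unique solution α₁(δ) in (0,∞); this solution lies in (1,∞) (so the connecting wave is a 1-shock) and satisfies |α₁(δ) − 1 − a_∞δ| ≤ Cδ². -/
/-- The 1-elementary wave curve of the isothermal hypersonic small-disturbance system. -/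
noncomputable def phi1 (a α : ℝ) : ℝ :=
  if α ≤ 1 then -(1 / a) * Real.log α
  else -(Real.sqrt 2 / a) * Real.sqrt ((α - 1) * Real.log α / (α + 1))

theorem strictMonoOn_sub_one_mul_log_div_add_one :
    StrictMonoOn (fun α : ℝ => (α - 1) * Real.log α / (α + 1)) (Set.Ici 1) := by
  intro x hx y hy hxy
  simp only [Set.mem_Ici] at hx hy
  have hlog : Real.log x < Real.log y := Real.log_lt_log (by linarith) hxy
  have hlog0 : 0 ≤ Real.log x := Real.log_nonneg hx
  have hdiv : (x - 1) / (x + 1) < (y - 1) / (y + 1) := by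
    rw [div_lt_div_iff₀ (by linarith) (by linarith)]
    nlinarith
  have hdiv0 : 0 ≤ (x - 1) / (x + 1) := div_nonneg (by linarith) (by linarith)
  simp only [mul_div_right_comm]
  exact mul_lt_mul'' hdiv hlog hdiv0 hlog0

theorem phi1_add_eq_zero_iff {a δ α : ℝ} (ha : 0 < a) (hδ : 0 < δ) (hα : 0 < α) :
    phi1 a α + δ = 0 ↔
      1 < α ∧ (α - 1) * Real.log α / (α + 1) = (a * δ) ^ 2 / 2 := by
  unfold phi1
  split_ifs with h
  · have hlog : Real.log α ≤ 0 := Real.log_nonpos hα.le h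
    have hmul : 0 ≤ 1 / a * -Real.log α :=
      mul_nonneg (by positivity) (by linarith)
    constructor
    · intro h0
      nlinarith
    · rintro ⟨h1, -⟩
      linarith
  · push Not at h
    have hnn : 0 ≤ (α - 1) * Real.log α / (α + 1) :=
      div_nonneg (mul_nonneg (by linarith) (Real.log_nonneg h.le)) (by linarith)
    generalize (α - 1) * Real.log α / (α + 1) = z at hnn ⊢
    have hsqrt : -(Real.sqrt 2 / a) * Real.sqrt z + δ = 0 ↔ Real.sqrt (2 * z) = a * δ := by
      rw [Real.sqrt_mul (by norm_num)]
      field_simp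
      constructor <;> intro h0 <;> linarith
    rw [hsqrt, Real.sqrt_eq_iff_eq_sq (by positivity) (by positivity)]
    constructor
    · intro h0
      exact ⟨h, by linarith⟩
    · rintro ⟨-, h0⟩
      linarith

theorem exists_sub_one_mul_log_div_add_one_eq {c : ℝ} (hc : 0 < c) (hc' : c < 1 / 2) :
    ∃ α : ℝ, 1 < α ∧ (α - 1) * Real.log α / (α + 1) = c := by
  have hcont : ContinuousOn (fun α : ℝ => (α - 1) * Real.log α / (α + 1)) (Set.Icc 1 3) := by
    refine ContinuousOn.div (ContinuousOn.mul (by fun_prop)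
      (Real.continuousOn_log.mono ?_)) (by fun_prop) ?_
    · intro x hx
      have := hx.1
      simp only [Set.mem_compl_iff, Set.mem_singleton_iff]
      linarith
    · intro x hx
      have := hx.1
      linarith
  have hlog : (1 : ℝ) ≤ Real.log 3 := by
    have := Real.le_log_one_add_of_nonneg (x := 2) (by norm_num)
    norm_num at this
    exact this
  obtain ⟨α, hα, h⟩ := intermediate_value_Icc (by norm_num) hcont
    (show c ∈ Set.Icc _ _ from ⟨by norm_num; exact hc.le, by norm_num; linarith⟩)
  refine ⟨α, lt_of_le_of_ne hα.1 ?_, h⟩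
  rintro rfl
  norm_num at h
  linarith

theorem abs_sub_one_sub_le_sq {e α : ℝ} (he : 0 < e) (he' : e < 1) (hα : 1 < α)
    (h : (α - 1) * Real.log α / (α + 1) = e ^ 2 / 2) :
    |α - 1 - e| ≤ e ^ 2 := by
  obtain ⟨t, rfl⟩ : ∃ t, α = 1 + t := ⟨α - 1, by ring⟩
  have ht : 0 < t := by linarith
  have hupper : Real.log (1 + t) ≤ t := by
    linarith [Real.log_le_sub_one_of_pos (show 0 < 1 + t by linarith)]
  have hlower := Real.le_log_one_add_of_nonneg ht.le
  have heq : e ^ 2 = 2 * t / (t + 2) * Real.log (1 + t) := by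
    rw [show 1 + t - 1 = t by ring, show 1 + t + 1 = t + 2 by ring] at h
    linear_combination -2 * h
  have hfrac0 : 0 ≤ 2 * t / (t + 2) := by positivity
  have hfrac : 2 * t / (t + 2) ≤ t := hlower.trans hupper
  have het : e ≤ t := by
    refine le_of_sq_le_sq ?_ ht.le
    rw [heq, sq]
    exact mul_le_mul hfrac hupper (hfrac0.trans hlower) ht.le
  have hte : 2 * t / (t + 2) ≤ e := by
    refine le_of_sq_le_sq ?_ he.le
    rw [heq, sq]
    exact mul_le_mul_of_nonneg_left hlower hfrac0
  rw [div_le_iff₀ (by linarith)] at hte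
  rw [abs_le]
  constructor
  · nlinarith
  · nlinarith

/-- There exist `δ₀ > 0` and `C > 0`, depending only on `a_∞`, such that for every
`δ ∈ (0, δ₀)`, the equation `φ₁(α) + δ = 0` has a unique solution `α₁(δ)` in `(0,∞)`;
that solution lies in `(1,∞)` (a 1-shock) and satisfies `|α₁(δ) − 1 − a_∞δ| ≤ Cδ²`. -/
theorem boundary_riemann_shock_expansion (a : ℝ) (ha : 0 < a) :
    ∃ δ₀ C : ℝ, 0 < δ₀ ∧ 0 < C ∧
      ∀ δ : ℝ, 0 < δ → δ < δ₀ →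
        (∃! α : ℝ, 0 < α ∧ phi1 a α + δ = 0) ∧
        ∀ α : ℝ, 0 < α → phi1 a α + δ = 0 →
          1 < α ∧ |α - 1 - a * δ| ≤ C * δ ^ 2 := by
  refine ⟨1 / a, a ^ 2, by positivity, by positivity, fun δ hδ hδ₀ => ?_⟩
  have he : 0 < a * δ := by positivity
  have he' : a * δ < 1 := by
    rwa [lt_div_iff₀ ha, mul_comm] at hδ₀
  constructor
  · obtain ⟨α, hα, h⟩ := exists_sub_one_mul_log_div_add_one_eq
      (c := (a * δ) ^ 2 / 2) (by positivity) (by nlinarith)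
    have hα0 : 0 < α := by linarith
    refine ⟨α, ⟨hα0, (phi1_add_eq_zero_iff ha hδ hα0).2 ⟨hα, h⟩⟩, ?_⟩
    rintro β ⟨hβ0, hβ⟩
    obtain ⟨hβ1, hβ⟩ := (phi1_add_eq_zero_iff ha hδ hβ0).1 hβ
    exact strictMonoOn_sub_one_mul_log_div_add_one.injOn (Set.mem_Ici.2 hβ1.le)
      (Set.mem_Ici.2 hα.le) (hβ.trans h.symm)
  · intro α hα0 h
    obtain ⟨hα, h⟩ := (phi1_add_eq_zero_iff ha hδ hα0).1 h
    refine ⟨hα, ?_⟩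
    rw [← mul_pow]
    exact abs_sub_one_sub_le_sq he he' hα h
end
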